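/- minadd ≤ add(SN(2^ω)); that is, there exists an increasing f ∈ ω^ω such that add(I_f) ≤ add(SN(2^ω)), where minadd := min{add(I_f) : f ∈ ω^ω increasing}. -/

import Mathlib

open Cardinal

/-- `s` is an initial segment of `x : ℕ → Bool`. -/
def IsInitSeg (s : List Bool) (x : ℕ → Bool) : Prop :=
  ∀ i : Fin s.length, s.get i = x i

/-- `[s]`: the basic clopen set of `x ∈ 2^ω` with initial segment `s`. -/
def cyl (s : List Bool) : Set (ℕ → Bool) := {x | IsInitSeg s x}

/-- `X ⊆ 2^ω` has strong measure zero: for every `f : ℕ → ℕ` there is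
`σ : ℕ → 2^{<ω}` with `|σ n| = f n` for all `n` such that `X ⊆ ⋃ n, [σ n]`. -/
def SMZ2 (X : Set (ℕ → Bool)) : Prop :=
  ∀ f : ℕ → ℕ, ∃ σ : ℕ → List Bool, (∀ n, (σ n).length = f n) ∧ X ⊆ ⋃ n, cyl (σ n)

/-- The ideal of strong measure zero subsets of `2^ω`. -/
def SN2 : Set (Set (ℕ → Bool)) := {X | SMZ2 X}

/-- `[σ]_∞`: the set of `x ∈ 2^ω` such that `σ n` is an initial segment of `x`
for infinitely many `n`. -/
def limsupCyl (σ : ℕ → List Bool) : Set (ℕ → Bool) :=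
  {x | ∀ m, ∃ n ≥ m, IsInitSeg (σ n) x}

/-- `f ≪ g`: for every `k`, `f ∘ pw_k ≤* g`, where `pw_k i = i ^ k`. -/
def LL (f g : ℕ → ℕ) : Prop :=
  ∀ k : ℕ, ∀ᶠ i in Filter.atTop, f (i ^ k) ≤ g i

/-- The Yorioka ideal `I_f`. -/
def Yorioka (f : ℕ → ℕ) : Set (Set (ℕ → Bool)) :=
  {X | ∃ σ : ℕ → List Bool, X ⊆ limsupCyl σ ∧ LL f (fun n => (σ n).length)}

/-- The additivity of a family of sets. -/
noncomputable def addOf {α : Type*} (I : Set (Set α)) : Cardinal :=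
  sInf {c | ∃ A : Set (Set α), A ⊆ I ∧ ⋃₀ A ∉ I ∧ c = #A}

/-- `s` is an initial segment of `x` iff their entries agree below `s.length`. -/
theorem isInitSeg_iff {s : List Bool} {x : ℕ → Bool} :
    IsInitSeg s x ↔ ∀ i (h : i < s.length), s[i] = x i :=
  ⟨fun H i h => H ⟨i, h⟩, fun H i => H i i.2⟩

theorem mem_cyl {s : List Bool} {x : ℕ → Bool} : x ∈ cyl s ↔ IsInitSeg s x := Iff.rfl

theorem isInitSeg_ofFn (x : ℕ → Bool) (n : ℕ) :
    IsInitSeg (List.ofFn fun i : Fin n => x i) x := by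
  rw [isInitSeg_iff]
  intro i h
  simp

theorem IsInitSeg.take {s : List Bool} {x : ℕ → Bool} (h : IsInitSeg s x) (n : ℕ) :
    IsInitSeg (s.take n) x := by
  rw [isInitSeg_iff] at h ⊢
  intro i hi
  rw [List.getElem_take]
  exact h i _

theorem singleton_mem_SN2 (x : ℕ → Bool) : {x} ∈ SN2 := by
  intro f
  refine ⟨fun n => List.ofFn fun i : Fin (f n) => x i, fun n => List.length_ofFn, ?_⟩
  rintro _ rfl
  exact Set.mem_iUnion.2 ⟨0, isInitSeg_ofFn _ _⟩

/-- The Cantor space does not have strong measure zero, by diagonalization. -/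
theorem univ_notMem_SN2 : Set.univ ∉ SN2 := by
  intro h
  obtain ⟨σ, hσ, hcov⟩ := h fun n => n + 1
  have hlt : ∀ n, n < (σ n).length := fun n => by rw [hσ]; exact n.lt_succ_self
  obtain ⟨n, hn⟩ := Set.mem_iUnion.1 (hcov (Set.mem_univ fun n => !((σ n)[n]'(hlt n))))
  have := isInitSeg_iff.1 (mem_cyl.1 hn) n (hlt n)
  simp at this

theorem LL_self_pow {f : ℕ → ℕ} (hf : Monotone f) : LL f fun i => f (i ^ i) := by
  intro k
  filter_upwards [Filter.eventually_ge_atTop (k + 1)] with i hi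
  exact hf (Nat.pow_le_pow_right (by omega) (by omega))

/-- Strong measure zero sets belong to every Yorioka ideal. -/
theorem SN2_subset_Yorioka {f : ℕ → ℕ} (hf : Monotone f) : SN2 ⊆ Yorioka f := by
  intro X hX
  choose σ hlen hcov using fun m => hX fun n => f (Nat.pair m n ^ Nat.pair m n)
  refine ⟨fun j => σ j.unpair.1 j.unpair.2, fun x hx m => ?_, ?_⟩
  · obtain ⟨n, hn⟩ := Set.mem_iUnion.1 (hcov m hx)
    refine ⟨Nat.pair m n, Nat.left_le_pair m n, ?_⟩
    simpa only [Nat.unpair_pair, mem_cyl] using hn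
  · simpa only [hlen, Nat.pair_unpair] using LL_self_pow hf

/-- A set in `I_f` is covered by basic clopen sets of any prescribed lengths below `f`. -/
theorem exists_cover_of_mem_Yorioka {f g : ℕ → ℕ} (hgf : g ≤ f) {X : Set (ℕ → Bool)}
    (hX : X ∈ Yorioka f) :
    ∃ σ : ℕ → List Bool, (∀ n, (σ n).length = g n) ∧ X ⊆ ⋃ n, cyl (σ n) := by
  obtain ⟨σ, hcov, hσ⟩ := hX
  obtain ⟨N, hN⟩ := Filter.eventually_atTop.1 (hσ 1)
  simp only [pow_one] at hN
  refine ⟨fun n => if N ≤ n then (σ n).take (g n) else List.replicate (g n) false,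
    fun n => ?_, fun x hx => ?_⟩
  · by_cases h : N ≤ n
    · simpa [h] using (hgf n).trans (hN n h)
    · simp [h]
  · obtain ⟨n, hn, hx⟩ := hcov hx N
    refine Set.mem_iUnion.2 ⟨n, ?_⟩
    simpa only [if_pos (ge_iff_le.1 hn)] using mem_cyl.2 (hx.take (g n))

theorem exists_strictMono_ge (g : ℕ → ℕ) : ∃ f : ℕ → ℕ, StrictMono f ∧ g ≤ f := by
  refine ⟨fun n => n + ∑ i ∈ Finset.range (n + 1), g i, strictMono_nat_of_lt_succ fun n => ?_,
    fun n => ?_⟩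
  · rw [Finset.sum_range_succ _ (n + 1)]
    omega
  · simp only [Finset.sum_range_succ]
    omega

/-- `minadd ≤ add(SN(2^ω))`: there is an increasing `f` with `add(I_f) ≤ add(SN)`. -/
theorem stmt14 : ∃ f : ℕ → ℕ, StrictMono f ∧ addOf (Yorioka f) ≤ addOf SN2 := by
  have hne : {c | ∃ A : Set (Set (ℕ → Bool)), A ⊆ SN2 ∧ ⋃₀ A ∉ SN2 ∧ c = #A}.Nonempty := by
    refine ⟨_, Set.range fun x => {x}, Set.range_subset_iff.2 singleton_mem_SN2, ?_, rfl⟩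
    rw [Set.sUnion_range, Set.iUnion_of_singleton]
    exact univ_notMem_SN2
  obtain ⟨A, hA, hUA, hc⟩ := csInf_mem hne
  obtain ⟨g, hg⟩ := not_forall.1 hUA
  obtain ⟨f, hf, hgf⟩ := exists_strictMono_ge g
  refine ⟨f, hf, csInf_le' ⟨A, hA.trans (SN2_subset_Yorioka hf.monotone), ?_, hc⟩⟩
  exact fun hU => hg (exists_cover_of_mem_Yorioka hgf hU)
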